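/- Under the adapted cuspidal-edge setting: if the mean curvature H_{ŴFC} of the focal surface ŴFC_f vanishes at every point of the u-axis, then the singular curvature κ_s is strictly positive at every point of the u-axis (indeed κ_s = κ_c²/4 > 0 there). -/

import Mathlib

noncomputable section

local notation "⟪" x ", " y "⟫" => @inner ℝ _ _ x y

/-- Euclidean 3-space. -/
abbrev E3 : Type := EuclideanSpace ℝ (Fin 3)

/-- The vector in `E3` with coordinates `(a, b, c)`. -/
def e3 (a b c : ℝ) : E3 := (WithLp.equiv 2 (Fin 3 → ℝ)).symm ![a, b, c]

/-- Cross product on `E3`. -/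
def cross3 (a b : E3) : E3 :=
  e3 (a 1 * b 2 - a 2 * b 1) (a 2 * b 0 - a 0 * b 2) (a 0 * b 1 - a 1 * b 0)

/-- Scalar triple product `det(a,b,c)`. -/
def det3 (a b c : E3) : ℝ := ⟪a, cross3 b c⟫

/-- Partial derivative in the `u`-direction. -/
def pu {E : Type*} [NormedAddCommGroup E] [NormedSpace ℝ E] (g : ℝ × ℝ → E) (p : ℝ × ℝ) : E :=
  fderiv ℝ g p (1, 0)

/-- Partial derivative in the `v`-direction. -/
def pv {E : Type*} [NormedAddCommGroup E] [NormedSpace ℝ E] (g : ℝ × ℝ → E) (p : ℝ × ℝ) : E :=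
  fderiv ℝ g p (0, 1)

/-- Signed area density `λ = det(f_u, f_v, ν)`. -/
def lam (f ν : ℝ × ℝ → E3) (p : ℝ × ℝ) : ℝ := det3 (pu f p) (pv f p) (ν p)


/-- `Ẽ = |f_u|²`. -/
def Etil (f : ℝ × ℝ → E3) (p : ℝ × ℝ) : ℝ := ‖pu f p‖ ^ 2

/-- `F̃ = ⟨f_u, h⟩`. -/
def Ftil (f h : ℝ × ℝ → E3) (p : ℝ × ℝ) : ℝ := ⟪pu f p, h p⟫

/-- `G̃ = |h|²`. -/
def Gtil (h : ℝ × ℝ → E3) (p : ℝ × ℝ) : ℝ := ‖h p‖ ^ 2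

/-- `L̃ = −⟨f_u, ν_u⟩`. -/
def Ltil (f ν : ℝ × ℝ → E3) (p : ℝ × ℝ) : ℝ := -⟪pu f p, pu ν p⟫

/-- `M̃ = −⟨h, ν_u⟩`. -/
def Mtil (ν h : ℝ × ℝ → E3) (p : ℝ × ℝ) : ℝ := -⟪h p, pu ν p⟫

/-- `Ñ = −⟨h, ν_v⟩`. -/
def Ntil (ν h : ℝ × ℝ → E3) (p : ℝ × ℝ) : ℝ := -⟪h p, pv ν p⟫

/-- `Ã = ẼÑ − 2vF̃M̃ + vG̃L̃`. -/
def Atil (f ν h : ℝ × ℝ → E3) (p : ℝ × ℝ) : ℝ :=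
  Etil f p * Ntil ν h p - 2 * p.2 * Ftil f h p * Mtil ν h p + p.2 * Gtil h p * Ltil f ν p

/-- `B̃ = √(Ã² − 4v(ẼG̃−F̃²)(L̃Ñ−vM̃²))`. -/
def Btil (f ν h : ℝ × ℝ → E3) (p : ℝ × ℝ) : ℝ :=
  Real.sqrt ((Atil f ν h p) ^ 2 -
    4 * p.2 * (Etil f p * Gtil h p - (Ftil f h p) ^ 2) *
      (Ltil f ν p * Ntil ν h p - p.2 * (Mtil ν h p) ^ 2))

/-- The bounded principal curvature `κ = 2(L̃Ñ−vM̃²)/(Ã+B̃)`. -/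
def kap (f ν h : ℝ × ℝ → E3) (p : ℝ × ℝ) : ℝ :=
  2 * (Ltil f ν p * Ntil ν h p - p.2 * (Mtil ν h p) ^ 2) / (Atil f ν h p + Btil f ν h p)

/-- `κ̂ = (Ã+B̃)/(2|f_u×h|)`, the smooth extension of `λ·κ₁`. -/
def kaphat (f ν h : ℝ × ℝ → E3) (p : ℝ × ℝ) : ℝ :=
  (Atil f ν h p + Btil f ν h p) / (2 * ‖cross3 (pu f p) (h p)‖)

/-- Singular curvature `κ_s` along the u-axis. -/
def kappas (f ν : ℝ × ℝ → E3) (u : ℝ) : ℝ :=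
  det3 (pu f (u, 0)) (pu (pu f) (u, 0)) (ν (u, 0)) / ‖pu f (u, 0)‖ ^ 3

/-- Cuspidal curvature `κ_c` along the u-axis. -/
def kappac (f ν h : ℝ × ℝ → E3) (u : ℝ) : ℝ :=
  2 * Etil f (u, 0) ^ ((3 : ℝ) / 4) * Ntil ν h (u, 0) /
    (Etil f (u, 0) * Gtil h (u, 0) - (Ftil f h (u, 0)) ^ 2) ^ ((3 : ℝ) / 4)

/-- Cusp-directional torsion `κ_t` along the u-axis. -/
def kappat (f ν h : ℝ × ℝ → E3) (u : ℝ) : ℝ :=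
  (Etil f (u, 0) * Mtil ν h (u, 0) - Ftil f h (u, 0) * Ltil f ν (u, 0)) /
    (Etil f (u, 0) * Real.sqrt (Etil f (u, 0) * Gtil h (u, 0) - (Ftil f h (u, 0)) ^ 2))

/-- The focal surface `ŴFC_f = f + (λ/κ̂)ν`. -/
def FChat (f ν h : ℝ × ℝ → E3) (p : ℝ × ℝ) : E3 :=
  f p + (lam f ν p / kaphat f ν h p) • ν p

/-- Coefficient `E` of the first fundamental form of a surface `W`. -/
def surfE (W : ℝ × ℝ → E3) (p : ℝ × ℝ) : ℝ := ‖pu W p‖ ^ 2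

/-- Coefficient `F` of the first fundamental form of a surface `W`. -/
def surfF (W : ℝ × ℝ → E3) (p : ℝ × ℝ) : ℝ := ⟪pu W p, pv W p⟫

/-- Coefficient `G` of the first fundamental form of a surface `W`. -/
def surfG (W : ℝ × ℝ → E3) (p : ℝ × ℝ) : ℝ := ‖pv W p‖ ^ 2

/-- Unit normal `n = (W_u × W_v)/|W_u × W_v|` of a surface `W`. -/
def surfn (W : ℝ × ℝ → E3) (p : ℝ × ℝ) : E3 :=
  ‖cross3 (pu W p) (pv W p)‖⁻¹ • cross3 (pu W p) (pv W p)

/-- Coefficient `L = ⟨W_uu, n⟩` of the second fundamental form. -/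
def surfL (W : ℝ × ℝ → E3) (p : ℝ × ℝ) : ℝ := ⟪pu (pu W) p, surfn W p⟫

/-- Coefficient `M = ⟨W_uv, n⟩` of the second fundamental form. -/
def surfM (W : ℝ × ℝ → E3) (p : ℝ × ℝ) : ℝ := ⟪pv (pu W) p, surfn W p⟫

/-- Coefficient `N = ⟨W_vv, n⟩` of the second fundamental form. -/
def surfN (W : ℝ × ℝ → E3) (p : ℝ × ℝ) : ℝ := ⟪pv (pv W) p, surfn W p⟫

/-- Gaussian curvature of a surface `W`. -/
def gaussK (W : ℝ × ℝ → E3) (p : ℝ × ℝ) : ℝ :=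
  (surfL W p * surfN W p - (surfM W p) ^ 2) /
    (surfE W p * surfG W p - (surfF W p) ^ 2)

/-- Mean curvature of a surface `W` (w.r.t. the unit normal `surfn W`). -/
def meanH (W : ℝ × ℝ → E3) (p : ℝ × ℝ) : ℝ :=
  (surfE W p * surfN W p - 2 * surfF W p * surfM W p + surfG W p * surfL W p) /
    (2 * (surfE W p * surfG W p - (surfF W p) ^ 2))


open scoped ContDiff

theorem e3_zero (a b c : ℝ) : e3 a b c 0 = a := rfl

theorem e3_one (a b c : ℝ) : e3 a b c 1 = b := rfl

theorem e3_two (a b c : ℝ) : e3 a b c 2 = c := rfl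

theorem E3_inner_eq (a b : E3) : (⟪a, b⟫ : ℝ) = a 0 * b 0 + a 1 * b 1 + a 2 * b 2 := by
  simp only [PiLp.inner_apply, Fin.sum_univ_three, RCLike.inner_apply, conj_trivial]
  ring

theorem inner_cross3_smul (x a n : E3) (c : ℝ) :
    (⟪x, cross3 a (c • n)⟫ : ℝ) = c * ⟪x, cross3 a n⟫ := by
  simp only [E3_inner_eq, cross3, e3_zero, e3_one, e3_two, PiLp.smul_apply, smul_eq_mul]
  ring

theorem cross3_smul_right (a n : E3) (c : ℝ) : cross3 a (c • n) = c • cross3 a n :=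
  ext_inner_left ℝ fun x => by rw [inner_cross3_smul, inner_smul_right]

theorem cross3_zero_left (b : E3) : cross3 0 b = 0 :=
  ext_inner_left ℝ fun x => by
    simp [E3_inner_eq, cross3, e3_zero, e3_one, e3_two]

theorem inner_cross3_rotate (x a n : E3) :
    (⟪x, cross3 a n⟫ : ℝ) = ⟪n, cross3 x a⟫ := by
  simp only [E3_inner_eq, cross3, e3_zero, e3_one, e3_two]
  ring

theorem inner_cross3_swap (x a n : E3) :
    (⟪x, cross3 a n⟫ : ℝ) = -⟪a, cross3 x n⟫ := by
  simp only [E3_inner_eq, cross3, e3_zero, e3_one, e3_two]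
  ring

theorem inner_self_cross3_right (a b : E3) : (⟪b, cross3 a b⟫ : ℝ) = 0 := by
  simp only [E3_inner_eq, cross3, e3_zero, e3_one, e3_two]
  ring

/-- Lagrange's identity. -/
theorem norm_cross3_sq (a b : E3) :
    ‖cross3 a b‖ ^ 2 = ‖a‖ ^ 2 * ‖b‖ ^ 2 - (⟪a, b⟫ : ℝ) ^ 2 := by
  simp only [← real_inner_self_eq_norm_sq, E3_inner_eq, cross3, e3_zero, e3_one, e3_two]
  ring

/-- A special case of the Gram determinant identity. -/
theorem inner_cross3_mul_inner_cross3 {x b a n : E3} (hn : ‖n‖ = 1) (han : (⟪a, n⟫ : ℝ) = 0)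
    (hnb : (⟪n, b⟫ : ℝ) = 0) (hab : (⟪a, b⟫ : ℝ) = 0) :
    (⟪x, cross3 a n⟫ : ℝ) * ⟪b, cross3 a n⟫ = ⟪x, b⟫ * ‖a‖ ^ 2 := by
  have hn2 : (⟪n, n⟫ : ℝ) = 1 := by rw [real_inner_self_eq_norm_sq, hn, one_pow]
  have key : (⟪x, cross3 a n⟫ : ℝ) * ⟪b, cross3 a n⟫ =
      ⟪x, b⟫ * (⟪a, a⟫ * ⟪n, n⟫ - ⟪a, n⟫ * ⟪a, n⟫)
        - ⟪x, a⟫ * (⟪a, b⟫ * ⟪n, n⟫ - ⟪a, n⟫ * ⟪n, b⟫)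
        + ⟪x, n⟫ * (⟪a, b⟫ * ⟪a, n⟫ - ⟪a, a⟫ * ⟪n, b⟫) := by
    simp only [E3_inner_eq, cross3, e3_zero, e3_one, e3_two]
    ring
  rw [key, hn2, han, hnb, hab, real_inner_self_eq_norm_sq]
  ring

theorem ContDiffAt.cross3 {a b : ℝ × ℝ → E3} {p : ℝ × ℝ} (ha : ContDiffAt ℝ ∞ a p)
    (hb : ContDiffAt ℝ ∞ b p) : ContDiffAt ℝ ∞ (fun q => cross3 (a q) (b q)) p := by
  rw [contDiffAt_euclidean] at ha hb ⊢
  intro i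
  fin_cases i
  · exact ((ha 1).mul (hb 2)).sub ((ha 2).mul (hb 1))
  · exact ((ha 2).mul (hb 0)).sub ((ha 0).mul (hb 2))
  · exact ((ha 0).mul (hb 1)).sub ((ha 1).mul (hb 0))

section DirectionalDerivative

variable {E : Type*} [NormedAddCommGroup E] [NormedSpace ℝ E]

theorem ContDiffAt.fderiv_apply_const {g : ℝ × ℝ → E} {p : ℝ × ℝ} (hg : ContDiffAt ℝ ∞ g p)
    (e : ℝ × ℝ) : ContDiffAt ℝ ∞ (fun q => fderiv ℝ g q e) p :=
  (hg.fderiv_right (m := ∞) (by simp)).clm_apply contDiffAt_const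

theorem ContDiffAt.differentiableAt_of_infty {g : ℝ × ℝ → E} {p : ℝ × ℝ}
    (hg : ContDiffAt ℝ ∞ g p) : DifferentiableAt ℝ g p :=
  hg.differentiableAt (by simp)

theorem pv_pu_eq_pu_pv {g : ℝ × ℝ → E} {p : ℝ × ℝ} (hg : ContDiffAt ℝ ∞ g p) :
    pv (pu g) p = pu (pv g) p := by
  have hd : DifferentiableAt ℝ (fderiv ℝ g) p :=
    (hg.fderiv_right (m := ∞) (by simp)).differentiableAt (by simp)
  have hs : IsSymmSndFDerivAt ℝ g p := hg.isSymmSndFDerivAt (by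
    simpa using WithTop.coe_le_coe.2 (le_top : (2 : ℕ∞) ≤ ⊤))
  have h1 : ∀ e : ℝ × ℝ, fderiv ℝ (fun q => fderiv ℝ g q e) p =
      (fderiv ℝ (fderiv ℝ g) p).flip e := fun e => by
    rw [fderiv_clm_apply hd (differentiableAt_const e)]
    simp
  change fderiv ℝ (fun q => fderiv ℝ g q (1, 0)) p (0, 1) =
    fderiv ℝ (fun q => fderiv ℝ g q (0, 1)) p (1, 0)
  rw [h1, h1]
  exact hs.eq _ _

theorem fderiv_snd_mul_smul {ν : ℝ × ℝ → E} {φ : ℝ × ℝ → ℝ} {q : ℝ × ℝ}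
    (hν : DifferentiableAt ℝ ν q) (hφ : DifferentiableAt ℝ φ q) (e : ℝ × ℝ) :
    fderiv ℝ (fun q => (q.2 * φ q) • ν q) q e =
      (q.2 * fderiv ℝ φ q e + e.2 * φ q) • ν q + (q.2 * φ q) • fderiv ℝ ν q e := by
  have h := (((hasFDerivAt_snd (𝕜 := ℝ) (p := q)).mul hφ.hasFDerivAt).smul hν.hasFDerivAt).fderiv
  change fderiv ℝ (fun q => (q.2 * φ q) • ν q) q = _ at h
  rw [h]
  simp [mul_comm, add_comm]

theorem fderiv_snd_smul {g : ℝ × ℝ → E} {q : ℝ × ℝ} (hg : DifferentiableAt ℝ g q)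
    (e : ℝ × ℝ) :
    fderiv ℝ (fun q => q.2 • g q) q e = q.2 • fderiv ℝ g q e + e.2 • g q := by
  have h := ((hasFDerivAt_snd (𝕜 := ℝ) (p := q)).smul hg.hasFDerivAt).fderiv
  change fderiv ℝ (fun q => q.2 • g q) q = _ at h
  rw [h]
  simp

theorem fderiv_add_snd_mul_smul {f ν : ℝ × ℝ → E} {φ : ℝ × ℝ → ℝ} {q : ℝ × ℝ}
    (hf : DifferentiableAt ℝ f q) (hν : DifferentiableAt ℝ ν q) (hφ : DifferentiableAt ℝ φ q)
    (e : ℝ × ℝ) :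
    fderiv ℝ (fun q => f q + (q.2 * φ q) • ν q) q e = fderiv ℝ f q e +
      ((q.2 * fderiv ℝ φ q e + e.2 * φ q) • ν q + (q.2 * φ q) • fderiv ℝ ν q e) := by
  have hd : DifferentiableAt ℝ (fun q : ℝ × ℝ => (q.2 * φ q) • ν q) q :=
    (differentiableAt_snd.mul hφ).smul hν
  rw [fderiv_fun_add hf hd, add_apply, fderiv_snd_mul_smul hν hφ]

theorem fderiv_fderiv_add_snd_mul_smul {f ν : ℝ × ℝ → E} {φ : ℝ × ℝ → ℝ} {p : ℝ × ℝ}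
    (hf : ContDiffAt ℝ ∞ f p) (hν : ContDiffAt ℝ ∞ ν p) (hφ : ContDiffAt ℝ ∞ φ p)
    (hp : p.2 = 0) (e : ℝ × ℝ) :
    fderiv ℝ (fun q => fderiv ℝ (fun q => f q + (q.2 * φ q) • ν q) q e) p e =
      fderiv ℝ (fun q => fderiv ℝ f q e) p e +
        ((2 * e.2 * fderiv ℝ φ p e) • ν p + (2 * e.2 * φ p) • fderiv ℝ ν p e) := by
  have hev : (fun q => fderiv ℝ (fun q => f q + (q.2 * φ q) • ν q) q e) =ᶠ[nhds p]
      fun q => fderiv ℝ f q e + ((q.2 * fderiv ℝ φ q e) • ν q + (e.2 * φ q) • ν q +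
        (q.2 * φ q) • fderiv ℝ ν q e) := by
    filter_upwards [(hf.of_le (m := 1) (by simp)).eventually (by simp),
      (hν.of_le (m := 1) (by simp)).eventually (by simp),
      (hφ.of_le (m := 1) (by simp)).eventually (by simp)] with q h1 h2 h3
    rw [fderiv_add_snd_mul_smul (h1.differentiableAt (by simp)) (h2.differentiableAt (by simp))
      (h3.differentiableAt (by simp)), add_smul]
  have df' := (hf.fderiv_apply_const e).differentiableAt_of_infty
  have dν' := (hν.fderiv_apply_const e).differentiableAt_of_infty
  have dφ' := (hφ.fderiv_apply_const e).differentiableAt_of_infty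
  have dν := hν.differentiableAt_of_infty
  have dφ := hφ.differentiableAt_of_infty
  have d1 : DifferentiableAt ℝ (fun q : ℝ × ℝ => (q.2 * fderiv ℝ φ q e) • ν q) p :=
    (differentiableAt_snd.mul dφ').smul dν
  have d2 : DifferentiableAt ℝ (fun q : ℝ × ℝ => (e.2 * φ q) • ν q) p :=
    (dφ.const_mul _).smul dν
  have d3 : DifferentiableAt ℝ (fun q : ℝ × ℝ => (q.2 * φ q) • fderiv ℝ ν q e) p :=
    (differentiableAt_snd.mul dφ).smul dν'
  have h2 : fderiv ℝ (fun q : ℝ × ℝ => (e.2 * φ q) • ν q) p e =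
      (e.2 * φ p) • fderiv ℝ ν p e + (e.2 * fderiv ℝ φ p e) • ν p := by
    rw [fderiv_fun_smul (dφ.const_mul _) dν, fderiv_const_mul dφ]
    simp
  rw [hev.fderiv_eq, fderiv_fun_add df' ((d1.fun_add d2).fun_add d3),
    fderiv_fun_add (d1.fun_add d2) d3, fderiv_fun_add d1 d2]
  simp only [add_apply]
  rw [fderiv_snd_mul_smul dν dφ', fderiv_snd_mul_smul dν' dφ, h2, hp]
  module

end DirectionalDerivative

theorem fderiv_inner_eq_zero {a b : ℝ × ℝ → E3} {p : ℝ × ℝ} {c : ℝ}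
    (ha : DifferentiableAt ℝ a p) (hb : DifferentiableAt ℝ b p)
    (hc : (fun q => (⟪a q, b q⟫ : ℝ)) =ᶠ[nhds p] fun _ => c) (e : ℝ × ℝ) :
    (⟪a p, fderiv ℝ b p e⟫ : ℝ) + ⟪fderiv ℝ a p e, b p⟫ = 0 := by
  rw [← fderiv_inner_apply ℝ ha hb, hc.fderiv_eq]
  simp

/-- The smooth function `φ` with `λ/κ̂ = v φ`. -/
def focalRadius (f ν h : ℝ × ℝ → E3) (p : ℝ × ℝ) : ℝ :=
  det3 (pu f p) (h p) (ν p) / kaphat f ν h p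

theorem kaphat_axis {f ν h : ℝ × ℝ → E3} {p : ℝ × ℝ} (hp : p.2 = 0) (hN : 0 < Ntil ν h p) :
    kaphat f ν h p = Etil f p * Ntil ν h p / ‖cross3 (pu f p) (h p)‖ := by
  have hA : Atil f ν h p = Etil f p * Ntil ν h p := by simp [Atil, hp]
  have hB : Btil f ν h p = Etil f p * Ntil ν h p := by
    have h0 : 0 ≤ Etil f p * Ntil ν h p := mul_nonneg (sq_nonneg _) hN.le
    simp [Btil, hp, hA, Real.sqrt_sq h0]
  rw [kaphat, hA, hB, ← two_mul, mul_div_mul_left _ _ two_ne_zero]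

theorem contDiffAt_kaphat {f ν h : ℝ × ℝ → E3} {p : ℝ × ℝ} (hf : ContDiffAt ℝ ∞ f p)
    (hν : ContDiffAt ℝ ∞ ν p) (hh : ContDiffAt ℝ ∞ h p) (hp : p.2 = 0)
    (hN : 0 < Ntil ν h p) (hw : cross3 (pu f p) (h p) ≠ 0) :
    ContDiffAt ℝ ∞ (kaphat f ν h) p := by
  have hE : Etil f p ≠ 0 := by
    refine pow_ne_zero 2 (norm_ne_zero_iff.2 fun h0 => hw ?_)
    rw [h0, cross3_zero_left]
  have cfu : ContDiffAt ℝ ∞ (pu f) p := hf.fderiv_apply_const _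
  have cνu : ContDiffAt ℝ ∞ (pu ν) p := hν.fderiv_apply_const _
  have cνv : ContDiffAt ℝ ∞ (pv ν) p := hν.fderiv_apply_const _
  have cE : ContDiffAt ℝ ∞ (Etil f) p := cfu.norm_sq ℝ
  have cG : ContDiffAt ℝ ∞ (Gtil h) p := hh.norm_sq ℝ
  have cF : ContDiffAt ℝ ∞ (Ftil f h) p := cfu.inner ℝ hh
  have cL : ContDiffAt ℝ ∞ (Ltil f ν) p := (cfu.inner ℝ cνu).neg
  have cM : ContDiffAt ℝ ∞ (Mtil ν h) p := (hh.inner ℝ cνu).neg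
  have cN : ContDiffAt ℝ ∞ (Ntil ν h) p := (hh.inner ℝ cνv).neg
  have cv : ContDiffAt ℝ ∞ (fun q : ℝ × ℝ => q.2) p := contDiffAt_snd
  have cA : ContDiffAt ℝ ∞ (Atil f ν h) p :=
    ((cE.mul cN).sub (((contDiffAt_const.mul cv).mul cF).mul cM)).add ((cv.mul cG).mul cL)
  have hA : Atil f ν h p = Etil f p * Ntil ν h p := by simp [Atil, hp]
  have cB : ContDiffAt ℝ ∞ (Btil f ν h) p := by
    refine ContDiffAt.sqrt ((cA.pow 2).sub (((contDiffAt_const.mul cv).mul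
      ((cE.mul cG).sub (cF.pow 2))).mul ((cL.mul cN).sub (cv.mul (cM.pow 2))))) ?_
    simp [hp, hA, hE, hN.ne']
  refine (cA.add cB).div (contDiffAt_const.mul ((cfu.cross3 hh).norm ℝ hw)) ?_
  simpa using hw


/-- if the mean curvature of the focal surface `ŴFC_f` vanishes along the
u-axis, then the singular curvature is strictly positive there; indeed `κ_s = κ_c²/4 > 0`. -/
theorem stmt17
    (U : Set (ℝ × ℝ)) (hU : IsOpen U)
    (f ν h : ℝ × ℝ → E3)
    (hf : ContDiffOn ℝ (⊤ : ℕ∞) f U) (hν : ContDiffOn ℝ (⊤ : ℕ∞) ν U) (hhsm : ContDiffOn ℝ (⊤ : ℕ∞) h U)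
    (hax : ∃ p ∈ U, p.2 = (0 : ℝ))
    (hν1 : ∀ p ∈ U, ‖ν p‖ = 1)
    (ho1 : ∀ p ∈ U, (⟪pu f p, ν p⟫ : ℝ) = 0)
    (ho2 : ∀ p ∈ U, (⟪pv f p, ν p⟫ : ℝ) = 0)
    (hfront : ∀ p ∈ U, Function.Injective ⇑(fderiv ℝ (fun q => (f q, ν q)) p))
    (hlam : ∀ p ∈ U, (lam f ν p = 0 ↔ p.2 = 0))
    (hh0 : ∀ p ∈ U, h p ≠ 0)
    (hfv : ∀ p ∈ U, pv f p = p.2 • h p)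
    (hνdef : ∀ p ∈ U, ν p = ‖cross3 (pu f p) (h p)‖⁻¹ • cross3 (pu f p) (h p))
    (hNpos : ∀ p ∈ U, p.2 = 0 → 0 < Ntil ν h p)
    (hH : ∀ u : ℝ, ((u, 0) : ℝ × ℝ) ∈ U → meanH (FChat f ν h) (u, 0) = 0) :
    ∀ u : ℝ, ((u, 0) : ℝ × ℝ) ∈ U →
      kappas f ν u = (kappac f ν h u) ^ 2 / 4 ∧ 0 < kappas f ν u := by
  intro u hu
  set p : ℝ × ℝ := (u, 0) with hp_def
  have hp : p.2 = 0 := rfl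
  have hUp : U ∈ nhds p := hU.mem_nhds hu
  have cf := hf.contDiffAt hUp
  have cν := hν.contDiffAt hUp
  have ch := hhsm.contDiffAt hUp
  have hN := hNpos p hu hp
  have hn1 := hν1 p hu
  have hw0 : cross3 (pu f p) (h p) ≠ 0 := fun h0 => by
    have := hνdef p hu
    rw [h0, smul_zero] at this
    simp [this] at hn1
  have ha0 : pu f p ≠ 0 := fun h0 => hw0 (by rw [h0, cross3_zero_left])
  have hw : 0 < ‖cross3 (pu f p) (h p)‖ := norm_pos_iff.2 hw0
  have ha : 0 < ‖pu f p‖ := norm_pos_iff.2 ha0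
  set w := ‖cross3 (pu f p) (h p)‖
  have hcross : cross3 (pu f p) (h p) = w • ν p := by
    rw [hνdef p hu, smul_smul, mul_inv_cancel₀ hw.ne', one_smul]
  have hdet : det3 (pu f p) (h p) (ν p) = w := by
    rw [det3, inner_cross3_rotate, hcross, inner_smul_right, real_inner_self_eq_norm_sq, hn1]
    ring
  have hκ : kaphat f ν h p = ‖pu f p‖ ^ 2 * Ntil ν h p / w := kaphat_axis hp hN
  have hκ0 : kaphat f ν h p ≠ 0 := by rw [hκ]; positivity
  have hφ : focalRadius f ν h p = w ^ 2 / (‖pu f p‖ ^ 2 * Ntil ν h p) := by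
    rw [focalRadius, hdet, hκ]
    field_simp
  have cfu : ContDiffAt ℝ ∞ (pu f) p := cf.fderiv_apply_const _
  have cφ : ContDiffAt ℝ ∞ (focalRadius f ν h) p :=
    (cfu.inner ℝ (ch.cross3 cν)).div (contDiffAt_kaphat cf cν ch hp hN hw0) hκ0
  set φ := focalRadius f ν h with hφ_def
  have hφ0 : 0 < φ p := by rw [hφ]; positivity
  have hW : FChat f ν h =ᶠ[nhds p] fun q => f q + (q.2 * φ q) • ν q := by
    filter_upwards [hUp] with q hq
    have : lam f ν q = q.2 * det3 (pu f q) (h q) (ν q) := by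
      rw [lam, hfv q hq, det3, det3, inner_cross3_rotate, inner_cross3_smul,
        ← inner_cross3_rotate (pu f q)]
    rw [FChat, this, mul_div_assoc, hφ_def, focalRadius]
  have hfirst : ∀ e : ℝ × ℝ, fderiv ℝ (FChat f ν h) p e =
      fderiv ℝ f p e + (e.2 * φ p) • ν p := fun e => by
    rw [hW.fderiv_eq, fderiv_add_snd_mul_smul cf.differentiableAt_of_infty
      cν.differentiableAt_of_infty cφ.differentiableAt_of_infty, hp]
    module
  have hsecond : ∀ e : ℝ × ℝ, fderiv ℝ (fun q => fderiv ℝ (FChat f ν h) q e) p e =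
      fderiv ℝ (fun q => fderiv ℝ f q e) p e +
        ((2 * e.2 * fderiv ℝ φ p e) • ν p + (2 * e.2 * φ p) • fderiv ℝ ν p e) := fun e => by
    have : (fun q => fderiv ℝ (FChat f ν h) q e) =ᶠ[nhds p]
        fun q => fderiv ℝ (fun q => f q + (q.2 * φ q) • ν q) q e := by
      filter_upwards [hW.fderiv (𝕜 := ℝ)] with q hq
      rw [hq]
    rw [this.fderiv_eq, fderiv_fderiv_add_snd_mul_smul cf cν cφ hp]
  have hfv_ev : pv f =ᶠ[nhds p] fun q => q.2 • h q := by
    filter_upwards [hUp] with q hq using hfv q hq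
  have hpvf : pv f p = 0 := by rw [hfv p hu, hp, zero_smul]
  have hpvpvf : pv (pv f) p = h p := by
    rw [pv, hfv_ev.fderiv_eq, fderiv_snd_smul ch.differentiableAt_of_infty, hp]
    simp
  have hpvpuf : pv (pu f) p = 0 := by
    rw [pv_pu_eq_pu_pv cf, pu, hfv_ev.fderiv_eq, fderiv_snd_smul ch.differentiableAt_of_infty, hp]
    simp
  have hWu : pu (FChat f ν h) p = pu f p := by
    rw [pu, hfirst]
    simp [pu]
  have hWv : pv (FChat f ν h) p = φ p • ν p := by
    have : fderiv ℝ f p (0, 1) = 0 := hpvf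
    rw [pv, hfirst, this]
    simp
  have hWuu : pu (pu (FChat f ν h)) p = pu (pu f) p := by
    refine (hsecond (1, 0)).trans ?_
    simp only [mul_zero, zero_mul, zero_smul, add_zero]
    rfl
  have hWvv : pv (pv (FChat f ν h)) p =
      h p + ((2 * pv φ p) • ν p + (2 * φ p) • pv ν p) := by
    rw [← hpvpvf]
    refine (hsecond (0, 1)).trans ?_
    simp only [mul_one]
    rfl
  have han := ho1 p hu
  have hnb : (⟪ν p, pv ν p⟫ : ℝ) = 0 := by
    have := fderiv_inner_eq_zero (c := 1) cν.differentiableAt_of_infty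
      cν.differentiableAt_of_infty (by
        filter_upwards [hUp] with q hq
        rw [real_inner_self_eq_norm_sq, hν1 q hq, one_pow]) (0, 1)
    rw [real_inner_comm (ν p) (fderiv ℝ ν p (0, 1))] at this
    change (⟪ν p, fderiv ℝ ν p (0, 1)⟫ : ℝ) = 0
    linarith
  have hab : (⟪pu f p, pv ν p⟫ : ℝ) = 0 := by
    have := fderiv_inner_eq_zero (c := 0) cfu.differentiableAt_of_infty
      cν.differentiableAt_of_infty (by filter_upwards [hUp] with q hq using ho1 q hq) (0, 1)
    rw [show fderiv ℝ (pu f) p (0, 1) = 0 from hpvpuf, inner_zero_left, add_zero] at this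
    exact this
  have hhx : (⟪h p, cross3 (pu f p) (ν p)⟫ : ℝ) = -w := by
    rw [inner_cross3_swap, ← hdet, det3]
  have hbx : (⟪pv ν p, cross3 (pu f p) (ν p)⟫ : ℝ) = Ntil ν h p * ‖pu f p‖ ^ 2 / w := by
    have := inner_cross3_mul_inner_cross3 (x := h p) hn1 han hnb hab
    rw [hhx] at this
    rw [eq_div_iff hw.ne', Ntil]
    linarith
  have hax_norm : ‖cross3 (pu f p) (ν p)‖ = ‖pu f p‖ := by
    have := norm_cross3_sq (pu f p) (ν p)
    rw [han, hn1] at this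
    exact (sq_eq_sq₀ (norm_nonneg _) (norm_nonneg _)).1 (by linarith)
  have hnormal : surfn (FChat f ν h) p = ‖pu f p‖⁻¹ • cross3 (pu f p) (ν p) := by
    rw [surfn, hWu, hWv, cross3_smul_right, norm_smul, hax_norm, Real.norm_of_nonneg hφ0.le,
      smul_smul]
    congr 1
    field_simp
  have hE : surfE (FChat f ν h) p = ‖pu f p‖ ^ 2 := by rw [surfE, hWu]
  have hF : surfF (FChat f ν h) p = 0 := by rw [surfF, hWu, hWv, inner_smul_right, han, mul_zero]
  have hG : surfG (FChat f ν h) p = φ p ^ 2 := by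
    rw [surfG, hWv, norm_smul, hn1, mul_one, Real.norm_of_nonneg hφ0.le]
  have hL : surfL (FChat f ν h) p =
      -(‖pu f p‖⁻¹ * det3 (pu f p) (pu (pu f) p) (ν p)) := by
    rw [surfL, hWuu, hnormal, inner_smul_right, inner_cross3_swap, det3, mul_neg]
  have hNn : surfN (FChat f ν h) p = w / ‖pu f p‖ := by
    rw [surfN, hWvv, hnormal, inner_smul_right, inner_add_left, inner_add_left,
      real_inner_smul_left, real_inner_smul_left, inner_self_cross3_right, hhx, hbx, hφ]
    field_simp
    ring
  have hHp := hH u hu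
  rw [meanH, hE, hF, hG, hL, hNn, div_eq_zero_iff] at hHp
  have hden : 2 * (‖pu f p‖ ^ 2 * φ p ^ 2 - 0 ^ 2) ≠ 0 := by
    have : 0 < ‖pu f p‖ ^ 2 * φ p ^ 2 := by positivity
    simpa using this.ne'
  have hnum := hHp.resolve_right hden
  have hks : kappas f ν u = ‖pu f p‖ ^ 3 * Ntil ν h p ^ 2 / w ^ 3 := by
    rw [hφ, mul_zero, zero_mul, sub_zero] at hnum
    rw [kappas, ← hp_def]
    generalize det3 (pu f p) (pu (pu f) p) (ν p) = d at hnum ⊢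
    field_simp at hnum ⊢
    refine mul_left_cancel₀ hw.ne' ?_
    linarith
  have hrpow : ∀ x : ℝ, 0 ≤ x → ((x ^ 2) ^ ((3 : ℝ) / 4)) ^ 2 = x ^ 3 := fun x hx => by
    rw [← Real.rpow_natCast x 2, ← Real.rpow_mul hx, ← Real.rpow_natCast (x ^ _) 2,
      ← Real.rpow_mul hx, ← Real.rpow_natCast x 3]
    norm_num
  have hkc : kappac f ν h u ^ 2 / 4 = ‖pu f p‖ ^ 3 * Ntil ν h p ^ 2 / w ^ 3 := by
    have hw2 : Etil f p * Gtil h p - Ftil f h p ^ 2 = w ^ 2 := (norm_cross3_sq _ _).symm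
    rw [kappac, ← hp_def, hw2, div_pow, mul_pow, mul_pow, hrpow w hw.le, Etil,
      hrpow _ ha.le]
    ring
  exact ⟨hks.trans hkc.symm, by rw [hks]; positivity⟩
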